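/- Let K be a compact Hausdorff space, k ≥ 1, and let P be an orthogonally additive continuous k-homogeneous polynomial on C(K). Then the set of complex Borel measures ν on the weak-* closed unit ball B' of the dual of C(K) satisfying P(x) = ∫_{B'} γ(x)^k dν(γ) for all x ∈ C(K) is nonempty, and the infimum of the total variations |ν|(B') over all such representing measures ν equals ‖P‖ = sup_{‖x‖≤1} |P(x)|. In other words, the integral norm and the usual norm of an orthogonally additive k-homogeneous polynomial on C(K) coincide. -/

import Mathlib

open MeasureTheory Filter Topology

open MeasureTheory Filter Topology

/-- `f` is orthogonally additive when it is additive on orthogonal pairs. -/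
def IsOrthAdd {K : Type*} [TopologicalSpace K] [CompactSpace K]
    (f : C(K, ℂ) → ℂ) : Prop :=
  ∀ x y : C(K, ℂ), x * y = 0 → f (x + y) = f x + f y

/-- `P` is a continuous `k`-homogeneous polynomial on `C(K, ℂ)`. -/
def IsHomogPoly {K : Type*} [TopologicalSpace K] [CompactSpace K]
    (k : ℕ) (P : C(K, ℂ) → ℂ) : Prop :=
  ∃ M : ContinuousMultilinearMap ℂ (fun _ : Fin k => C(K, ℂ)) ℂ,
    ∀ x : C(K, ℂ), P x = M (fun _ => x)

/-- The norm `‖P‖ = sup_{‖x‖ ≤ 1} |P x|` of a polynomial on `C(K, ℂ)`. -/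
noncomputable def polyNorm {K : Type*} [TopologicalSpace K] [CompactSpace K]
    (P : C(K, ℂ) → ℂ) : ℝ :=
  sSup ((fun x => ‖P x‖) '' Metric.closedBall (0 : C(K, ℂ)) 1)

/-- The closed unit ball of the dual of `C(K, ℂ)`, with the weak-* topology. -/
abbrev DualBall (K : Type*) [TopologicalSpace K] [CompactSpace K] : Type _ :=
  {γ : WeakDual ℂ C(K, ℂ) // ∀ x : C(K, ℂ), ‖γ x‖ ≤ ‖x‖}

/-- Borel σ-algebra on the weak-* dual unit ball. -/
noncomputable instance (K : Type*) [TopologicalSpace K] [CompactSpace K] :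
    MeasurableSpace (DualBall K) := borel (DualBall K)



section PolarizationPart

lemma aux_toggle {ι : Type*} [Fintype ι] [DecidableEq ι] (b : ι) (F : Finset ι → ℂ)
    (hF : ∀ T, b ∉ T → F (insert b T) = F T) :
    ∑ T : Finset ι, (-1 : ℂ) ^ T.card * F T = 0 := by
  rw [← Finset.powerset_univ, ← Finset.insert_erase (Finset.mem_univ b),
    Finset.sum_powerset_insert (Finset.notMem_erase b _), ← Finset.sum_add_distrib]
  refine Finset.sum_eq_zero fun T hT => ?_
  have hb : b ∉ T := fun h => by
    have := Finset.mem_powerset.1 hT h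
    simp at this
  rw [hF T hb, Finset.card_insert_of_notMem hb]
  ring

lemma aux_polarization {E : Type*} [AddCommGroup E] [Module ℂ E] {k : ℕ}
    (M : MultilinearMap ℂ (fun _ : Fin k => E) ℂ) (x : Fin k → E) :
    ∑ T : Finset (Fin k), (-1 : ℂ) ^ T.card * M (fun _ => ∑ i ∈ T, x i) =
      (-1) ^ k * ∑ σ : Equiv.Perm (Fin k), M (fun i => x (σ i)) := by
  classical
  have h1 : ∀ T : Finset (Fin k), M (fun _ => ∑ i ∈ T, x i) =
      ∑ f : Fin k → Fin k, (if ∀ j, f j ∈ T then 1 else 0) * M (fun i => x (f i)) := by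
    intro T
    have := M.map_sum_finset (fun _ i => x i) (fun _ => T)
    rw [this]
    simp only [ite_mul, one_mul, zero_mul]
    rw [← Finset.sum_filter]
    refine Finset.sum_congr ?_ fun _ _ => rfl
    ext f
    simp [Fintype.mem_piFinset]
  simp_rw [h1, Finset.mul_sum]
  rw [Finset.sum_comm]
  symm
  refine Finset.sum_of_injOn (fun σ : Equiv.Perm (Fin k) => (σ : Fin k → Fin k)) ?_ ?_ ?_ ?_
  · intro a _ b _ h
    exact DFunLike.coe_injective h
  · intro a _
    simp
  · intro f _ hf
    have hns : ¬ Function.Surjective f := by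
      intro hs
      apply hf
      exact ⟨Equiv.ofBijective f (Finite.surjective_iff_bijective.1 hs), by simp, by ext; simp⟩
    simp only [Function.Surjective, not_forall, not_exists] at hns
    obtain ⟨b, hb⟩ := hns
    have := aux_toggle b (fun T => (if ∀ j, f j ∈ T then (1 : ℂ) else 0) * M (fun i => x (f i))) (by
      intro T _
      have : (∀ j, f j ∈ insert b T) ↔ ∀ j, f j ∈ T := by
        refine forall_congr' fun j => ?_
        simp [hb j]
      simp only [this])
    exact this
  · intro σ _
    rw [Finset.sum_eq_single Finset.univ]
    · simp
    · intro T _ hT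
      have : ¬ ∀ j, σ j ∈ T := by
        intro h
        apply hT
        ext j
        simp
        simpa using h (σ.symm j)
      simp [this]
    · simp

end PolarizationPart

section GapPart

variable {K : Type*} [TopologicalSpace K] [CompactSpace K]

noncomputable def auxRmp (t : ℝ) : ℝ := max 0 (min t 1)

lemma auxRmp_cont : Continuous auxRmp := by unfold auxRmp; fun_prop

lemma auxRmp_nonneg (t : ℝ) : 0 ≤ auxRmp t := le_max_left _ _
lemma auxRmp_le (t : ℝ) : auxRmp t ≤ 1 := max_le zero_le_one (min_le_right _ _)
lemma auxRmp_zero {t : ℝ} (h : t ≤ 0) : auxRmp t = 0 := by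
  unfold auxRmp; exact max_eq_left ((min_le_left _ _).trans h)
lemma auxRmp_one {t : ℝ} (h : 1 ≤ t) : auxRmp t = 1 := by
  unfold auxRmp; rw [min_eq_right h]; simp
lemma auxRmp_mid {t : ℝ} (h : 0 ≤ t) (h' : t ≤ 1) : auxRmp t = t := by
  unfold auxRmp; rw [min_eq_left h', max_eq_right h]
lemma auxRmp_mono {s t : ℝ} (h : s ≤ t) : auxRmp s ≤ auxRmp t := by
  unfold auxRmp; gcongr

/-- bump supported in `[n+1/9, n+8/9]`, equal to one on `[n+2/9, n+7/9]` -/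
noncomputable def auxChi (n : ℕ) (t : ℝ) : ℝ :=
  auxRmp (9 * (t - n) - 1) - auxRmp (9 * (t - n) - 7)

lemma auxChi_cont (n : ℕ) : Continuous (auxChi n) := by
  unfold auxChi
  have := auxRmp_cont
  fun_prop

lemma auxChi_nonneg (n : ℕ) (t : ℝ) : 0 ≤ auxChi n t := by
  have := @auxRmp_mono (9 * (t - n) - 7) (9 * (t - n) - 1) (by linarith)
  unfold auxChi; linarith
lemma auxChi_le (n : ℕ) (t : ℝ) : auxChi n t ≤ 1 := by
  have := auxRmp_nonneg (9 * (t - n) - 7)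
  have := auxRmp_le (9 * (t - n) - 1)
  unfold auxChi; linarith
lemma auxChi_supp {n : ℕ} {t : ℝ} (h : auxChi n t ≠ 0) : n + 1/9 ≤ t ∧ t ≤ n + 8/9 := by
  constructor
  · by_contra hc
    apply h
    unfold auxChi
    rw [auxRmp_zero (by linarith), auxRmp_zero (by linarith)]; simp
  · by_contra hc
    apply h
    unfold auxChi
    rw [auxRmp_one (by linarith), auxRmp_one (by linarith)]; simp
lemma auxChi_one {n : ℕ} {t : ℝ} (h : n + 2/9 ≤ t) (h' : t ≤ n + 7/9) : auxChi n t = 1 := by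
  unfold auxChi
  rw [auxRmp_one (by linarith), auxRmp_zero (by linarith)]; simp

lemma auxChi_disj {n m : ℕ} (hnm : n < m) {t : ℝ} : ¬ (t ≤ n + 1 ∧ m < t) := by
  rintro ⟨h1, h2⟩
  have : (n : ℝ) + 1 ≤ m := by exact_mod_cast hnm
  linarith

lemma aux_sum_disj (s : Finset ℕ) (f : ℕ → ℂ) {C : ℝ} (hC : 0 ≤ C) (h1 : ∀ n, ‖f n‖ ≤ C)
    (h2 : ∀ n m, n < m → f n ≠ 0 → f m ≠ 0 → False) : ‖∑ n ∈ s, f n‖ ≤ C := by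
  by_cases h : ∃ n ∈ s, f n ≠ 0
  · obtain ⟨n, hn, hfn⟩ := h
    rw [Finset.sum_eq_single n]
    · exact h1 n
    · intro m _ hmn
      by_contra hfm
      rcases lt_or_gt_of_ne hmn with h | h
      · exact h2 _ _ h hfm hfn
      · exact h2 _ _ h hfn hfm
    · intro h; exact absurd hn h
  · push Not at h
    rw [Finset.sum_eq_zero h]
    simpa using hC

/-- composition of a real function with a continuous real function, as complex function -/
noncomputable def auxComp (H : C(K, ℝ)) (g : ℝ → ℝ) (hg : Continuous g) : C(K, ℂ) :=
  ⟨fun p => ((g (H p) : ℝ) : ℂ), by fun_prop⟩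

lemma auxComp_apply (H : C(K, ℝ)) (g : ℝ → ℝ) (hg : Continuous g) (p : K) :
    auxComp H g hg p = ((g (H p) : ℝ) : ℂ) := rfl

lemma aux_chi_sum_norm (H : C(K, ℝ)) (N : ℕ) (x : C(K, ℂ)) (y : ℕ → C(K, ℂ))
    (hy : ∀ n p, y n p ≠ 0 → n < H p ∧ H p ≤ n + 1)
    (hy' : ∀ n p, ‖y n p‖ ≤ ‖x p‖) :
    ‖∑ n ∈ Finset.range N, y n‖ ≤ ‖x‖ := by
  refine (ContinuousMap.norm_le _ (norm_nonneg _)).2 fun p => ?_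
  rw [ContinuousMap.sum_apply]
  refine aux_sum_disj _ _ (norm_nonneg _) (fun n => (hy' n p).trans (x.norm_coe_le_norm p)) ?_
  intro n m hnm h1 h2
  exact auxChi_disj hnm ⟨(hy n p h1).2, (hy m p h2).1⟩

lemma aux_arch {a C : ℝ} (ha : 0 ≤ a) (h : ∀ N : ℕ, 0 < N → N * a ≤ C) : a = 0 := by
  by_contra hne
  have hpos : 0 < a := lt_of_le_of_ne ha (Ne.symm hne)
  obtain ⟨N, hN⟩ := exists_nat_gt (C / a)
  have h1 := h (N + 1) (Nat.succ_pos _)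
  rw [div_lt_iff₀ hpos] at hN
  push_cast at h1
  linarith

lemma aux_gap {k : ℕ} (S : ContinuousMultilinearMap ℂ (fun _ : Fin k => C(K, ℂ)) ℂ)
    (h : C(K, ℝ))
    (hsplit : ∀ a b : ℝ, a < b → ∀ A : Finset (Fin k), A.Nonempty → (∃ j, j ∉ A) →
      ∀ x : Fin k → C(K, ℂ), (∀ i ∈ A, ∀ p, x i p ≠ 0 → h p ≤ a) →
      (∀ i ∉ A, ∀ p, x i p ≠ 0 → b ≤ h p) → S x = 0)
    (F : Finset (Fin k)) : ∀ (a b : ℝ), a < b → ∀ A B : Finset (Fin k), A.Nonempty → B.Nonempty →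
      (∀ i, i ∈ A ∨ i ∈ B ∨ i ∈ F) →
      ∀ x : Fin k → C(K, ℂ), (∀ i ∈ A, ∀ p, x i p ≠ 0 → h p ≤ a) →
      (∀ i ∈ B, ∀ p, x i p ≠ 0 → b ≤ h p) → S x = 0 := by
  classical
  induction F using Finset.induction_on with
  | empty =>
    intro a b hab A B hA hB hAB x hxA hxB
    obtain ⟨j, hj⟩ := hB
    by_cases hjA : j ∈ A
    · refine S.map_coord_zero j ?_
      ext p
      by_contra hne
      have h1 := hxA j hjA p hne
      have h2 := hxB j hj p hne
      linarith
    · refine hsplit a b hab A hA ⟨j, hjA⟩ x hxA fun i hi => hxB i ?_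
      have := hAB i
      simp [hi] at this
      exact this
  | insert i F _ ih =>
    intro a b hab A B hA hB hAB x hxA hxB
    set L := S.toContinuousLinearMap x i with hL
    have hLx : L (x i) = S x := by
      simp [hL]
    rw [← norm_eq_zero]
    refine aux_arch (C := ‖L‖ * ‖x i‖) (norm_nonneg _) fun N hN => ?_
    have hN' : (0 : ℝ) < N := by exact_mod_cast hN
    have hba : 0 < b - a := by linarith
    let H : C(K, ℝ) := ⟨fun p => N * (h p - a) / (b - a), by fun_prop⟩
    have hH : ∀ p, H p = N * (h p - a) / (b - a) := fun p => rfl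
    have hle : ∀ c p, H p ≤ c → h p ≤ a + c * (b - a) / N := by
      intro c p hc
      rw [hH, div_le_iff₀ hba] at hc
      rw [← sub_le_iff_le_add', le_div_iff₀ hN']
      linarith
    have hge : ∀ c p, c ≤ H p → a + c * (b - a) / N ≤ h p := by
      intro c p hc
      rw [hH, le_div_iff₀ hba] at hc
      rw [← le_sub_iff_add_le', div_le_iff₀ hN']
      linarith
    let χ : ℕ → C(K, ℂ) := fun n => auxComp H (auxChi n) (auxChi_cont n)
    have key : ∀ n ∈ Finset.range N, L (x i * χ n) = S x := by
      intro n hn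
      have hnN : n + 1 ≤ N := Finset.mem_range.1 hn
      have hnN' : (n : ℝ) + 1 ≤ N := by exact_mod_cast hnN
      have hn0 : (0 : ℝ) ≤ n := Nat.cast_nonneg n
      let u : C(K, ℂ) := auxComp H (fun t => 1 - auxRmp (9 * (t - n) - 1))
        (by have := auxRmp_cont; fun_prop)
      let v : C(K, ℂ) := auxComp H (fun t => auxRmp (9 * (t - n) - 7))
        (by have := auxRmp_cont; fun_prop)
      have hu : ∀ p, u p ≠ 0 → H p ≤ n + 2/9 := by
        intro p hp
        by_contra hc
        apply hp
        simp only [u, auxComp_apply]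
        rw [auxRmp_one (by linarith)]; simp
      have hv : ∀ p, v p ≠ 0 → n + 7/9 ≤ H p := by
        intro p hp
        by_contra hc
        apply hp
        simp only [v, auxComp_apply]
        rw [auxRmp_zero (by linarith)]; simp
      have hdec : x i = x i * u + x i * χ n + x i * v := by
        ext p
        simp only [ContinuousMap.add_apply, ContinuousMap.mul_apply, u, v, χ, auxComp_apply, auxChi]
        push_cast
        ring
      set a' := a + (n + 2/9) * (b - a) / N with ha'
      set b' := a + (n + 7/9) * (b - a) / N with hb'
      have haa' : a ≤ a' := by rw [ha']; have : 0 ≤ (n + 2/9) * (b - a) / N := by positivity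
                               linarith
      have hab' : a' < b' := by
        rw [ha', hb']; gcongr; norm_num
      have hbb' : b' ≤ b := by
        have : (n + 7/9) * (b - a) / N ≤ b - a := by
          rw [div_le_iff₀ hN', mul_comm]; gcongr; linarith
        rw [hb']; linarith
      have hzu : L (x i * u) = 0 := by
        rw [hL]
        change S (Function.update x i (x i * u)) = 0
        refine ih a' b' hab' (insert i A) B (Finset.insert_nonempty _ _) hB ?_ _ ?_ ?_
        · intro j
          have := hAB j
          simp only [Finset.mem_insert] at this ⊢
          tauto
        · intro j hj p hp
          by_cases hji : j = i
          · subst hji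
            rw [Function.update_self] at hp
            exact hle _ _ (hu p (right_ne_zero_of_mul hp))
          · rw [Function.update_of_ne hji] at hp
            have := hxA j (by simpa [hji] using hj) p hp
            linarith
        · intro j hj p hp
          by_cases hji : j = i
          · subst hji
            rw [Function.update_self] at hp
            have := hxB j hj p (left_ne_zero_of_mul hp)
            linarith
          · rw [Function.update_of_ne hji] at hp
            have := hxB j hj p hp
            linarith
      have hzv : L (x i * v) = 0 := by
        rw [hL]
        change S (Function.update x i (x i * v)) = 0
        refine ih a' b' hab' A (insert i B) hA (Finset.insert_nonempty _ _) ?_ _ ?_ ?_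
        · intro j
          have := hAB j
          simp only [Finset.mem_insert] at this ⊢
          tauto
        · intro j hj p hp
          by_cases hji : j = i
          · subst hji
            rw [Function.update_self] at hp
            have := hxA j hj p (left_ne_zero_of_mul hp)
            linarith
          · rw [Function.update_of_ne hji] at hp
            have := hxA j hj p hp
            linarith
        · intro j hj p hp
          by_cases hji : j = i
          · subst hji
            rw [Function.update_self] at hp
            exact hge _ _ (hv p (right_ne_zero_of_mul hp))
          · rw [Function.update_of_ne hji] at hp
            have := hxB j (by simpa [hji] using hj) p hp
            linarith
      rw [← hLx]
      conv_rhs => rw [hdec]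
      rw [map_add, map_add, hzu, hzv]; simp
    have hsum : (N : ℂ) * S x = L (∑ n ∈ Finset.range N, x i * χ n) := by
      rw [map_sum, Finset.sum_congr rfl key]; simp
    have : N * ‖S x‖ = ‖L (∑ n ∈ Finset.range N, x i * χ n)‖ := by
      rw [← hsum]; simp
    rw [this]
    refine (L.le_opNorm _).trans ?_
    gcongr
    refine aux_chi_sum_norm H N (x i) _ ?_ ?_
    · intro n p hp
      have h1 : χ n p ≠ 0 := right_ne_zero_of_mul hp
      have := auxChi_supp (n := n) (t := H p) (by
        intro h0; apply h1; simp [χ, auxComp_apply, h0])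
      constructor <;> linarith [this.1, this.2]
    · intro n p
      simp only [ContinuousMap.mul_apply, norm_mul, χ, auxComp_apply, Complex.norm_real,
        Real.norm_eq_abs]
      rw [abs_of_nonneg (auxChi_nonneg _ _)]
      exact mul_le_of_le_one_right (norm_nonneg _) (auxChi_le _ _)

end GapPart

section BilPart

variable {K : Type*} [TopologicalSpace K] [CompactSpace K]

lemma auxRmp_sum (N : ℕ) (t : ℝ) :
    ∑ n ∈ Finset.range N, auxRmp (t - n) = max 0 (min t N) := by
  induction N with
  | zero => simp
  | succ N ih =>
    rw [Finset.sum_range_succ, ih]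
    have hN : (0 : ℝ) ≤ N := Nat.cast_nonneg N
    push_cast
    rcases le_total t N with h | h
    · rw [auxRmp_zero (by linarith), min_eq_left h, min_eq_left (by linarith)]; simp
    · rw [min_eq_right h, max_eq_right hN]
      rcases le_total t (N + 1) with h' | h'
      · rw [auxRmp_mid (by linarith) (by linarith), min_eq_left h', max_eq_right (by linarith)]
        ring
      · rw [auxRmp_one (by linarith), min_eq_right h', max_eq_right (by linarith)]

lemma aux_diag (B : C(K, ℂ) →ₗ[ℂ] C(K, ℂ) →ₗ[ℂ] ℂ) {C : ℝ} (hC : 0 ≤ C)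
    (hBC : ∀ x y, ‖B x y‖ ≤ C * ‖x‖ * ‖y‖) (H : C(K, ℝ))
    (hB : ∀ a b : ℝ, a < b → ∀ x y : C(K, ℂ), (∀ p, x p ≠ 0 → H p ≤ a) →
      (∀ p, y p ≠ 0 → b ≤ H p) → B x y = 0)
    (hB' : ∀ a b : ℝ, a < b → ∀ x y : C(K, ℂ), (∀ p, x p ≠ 0 → H p ≤ a) →
      (∀ p, y p ≠ 0 → b ≤ H p) → B y x = 0)
    (x y : C(K, ℂ)) (u v : ℕ → C(K, ℂ))
    (hu : ∀ n p, u n p ≠ 0 → n + 1/9 ≤ H p ∧ H p ≤ n + 8/9)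
    (hv : ∀ n p, v n p ≠ 0 → n + 1/9 ≤ H p ∧ H p ≤ n + 8/9)
    (hu' : ∀ n p, ‖u n p‖ ≤ ‖x p‖) (hv' : ∀ n p, ‖v n p‖ ≤ ‖y p‖) (N : ℕ) :
    ‖∑ n ∈ Finset.range N, B (u n) (v n)‖ ≤ C * ‖x‖ * ‖y‖ := by
  have h1 : ∑ n ∈ Finset.range N, B (u n) (v n) =
      B (∑ n ∈ Finset.range N, u n) (∑ n ∈ Finset.range N, v n) := by
    rw [map_sum B, LinearMap.sum_apply]
    refine Finset.sum_congr rfl fun n hn => ?_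
    rw [map_sum, Finset.sum_eq_single n]
    · intro m _ hmn
      rcases lt_or_gt_of_ne hmn with h | h
      · have : (m : ℝ) + 1 ≤ n := by exact_mod_cast h
        exact hB' (m + 8/9) (n + 1/9) (by linarith) _ _ (fun p hp => (hv m p hp).2)
          (fun p hp => (hu n p hp).1)
      · have : (n : ℝ) + 1 ≤ m := by exact_mod_cast h
        exact hB (n + 8/9) (m + 1/9) (by linarith) _ _ (fun p hp => (hu n p hp).2)
          (fun p hp => (hv m p hp).1)
    · intro h; exact absurd hn h
  rw [h1]
  refine (hBC _ _).trans ?_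
  have e1 := aux_chi_sum_norm H N x u (fun n p hp => by
    have := hu n p hp; constructor <;> linarith [this.1, this.2]) hu'
  have e2 := aux_chi_sum_norm H N y v (fun n p hp => by
    have := hv n p hp; constructor <;> linarith [this.1, this.2]) hv'
  gcongr

lemma aux_bil_unit (B : C(K, ℂ) →ₗ[ℂ] C(K, ℂ) →ₗ[ℂ] ℂ) {C : ℝ} (hC : 0 ≤ C)
    (hBC : ∀ x y, ‖B x y‖ ≤ C * ‖x‖ * ‖y‖)
    (hB : ∀ (H : C(K, ℝ)) (a b : ℝ), a < b → ∀ x y : C(K, ℂ), (∀ p, x p ≠ 0 → H p ≤ a) →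
      (∀ p, y p ≠ 0 → b ≤ H p) → B x y = 0)
    (h : C(K, ℝ)) (h0 : ∀ p, 0 ≤ h p) (h1 : ∀ p, h p ≤ 1) (x y : C(K, ℂ)) :
    B (auxComp h id continuous_id * x) y = B x (auxComp h id continuous_id * y) := by
  have hB' : ∀ (H : C(K, ℝ)) (a b : ℝ), a < b → ∀ x y : C(K, ℂ), (∀ p, x p ≠ 0 → H p ≤ a) →
      (∀ p, y p ≠ 0 → b ≤ H p) → B y x = 0 := by
    intro H a b hab x y hx hy
    refine hB (-H) (-b) (-a) (by linarith) y x ?_ ?_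
    · intro p hp
      have := hy p hp
      simpa using this
    · intro p hp
      have := hx p hp
      simpa using this
  let D : C(K, ℂ) →ₗ[ℂ] ℂ :=
    { toFun := fun z => B (z * x) y - B x (z * y)
      map_add' := by
        intro z w
        simp only [add_mul, map_add, LinearMap.add_apply]; ring
      map_smul' := by
        intro c z
        simp only [smul_mul_assoc, map_smul, LinearMap.smul_apply, smul_eq_mul,
          RingHom.id_apply]; ring }
  have hD : ∀ z, D z = B (z * x) y - B x (z * y) := fun z => rfl
  have hDn : ∀ z, ‖D z‖ ≤ 2 * C * ‖z‖ * ‖x‖ * ‖y‖ := by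
    intro z
    rw [hD]
    have e1 : ‖B (z * x) y‖ ≤ C * (‖z‖ * ‖x‖) * ‖y‖ := (hBC _ _).trans (by gcongr; exact norm_mul_le _ _)
    have e2 : ‖B x (z * y)‖ ≤ C * ‖x‖ * (‖z‖ * ‖y‖) := (hBC _ _).trans (by gcongr; exact norm_mul_le _ _)
    refine (norm_sub_le _ _).trans ?_
    linarith
  rw [← sub_eq_zero, ← hD, ← norm_eq_zero]
  refine aux_arch (C := 2 * (C * ‖x‖ * ‖y‖) + 2 * C * ‖(1 : C(K, ℂ))‖ * ‖x‖ * ‖y‖)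
    (norm_nonneg _) fun N hN => ?_
  let H : C(K, ℝ) := ⟨fun p => N * h p, by fun_prop⟩
  have hH : ∀ p, H p = N * h p := fun p => rfl
  have cr := auxRmp_cont
  let w : ℕ → C(K, ℂ) := fun n => auxComp H (fun t => auxRmp (9 * (t - n) - 4)) (by fun_prop)
  let e : ℕ → C(K, ℂ) := fun n =>
    auxComp H (fun t => auxRmp (t - n) - auxRmp (9 * (t - n) - 4)) (by fun_prop)
  let χ : ℕ → C(K, ℂ) := fun n => auxComp H (auxChi n) (auxChi_cont n)
  have hw : ∀ n p, w n p = ((auxRmp (9 * (H p - n) - 4) : ℝ) : ℂ) := fun n p => rfl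
  have hχ : ∀ n p, χ n p = ((auxChi n (H p) : ℝ) : ℂ) := fun n p => rfl
  have hχ1 : ∀ n p, ‖χ n p‖ ≤ 1 := by
    intro n p
    rw [hχ, Complex.norm_real, Real.norm_eq_abs, abs_of_nonneg (auxChi_nonneg _ _)]
    exact auxChi_le _ _
  have hw1 : ∀ n p, ‖w n p‖ ≤ 1 := by
    intro n p
    rw [hw, Complex.norm_real, Real.norm_eq_abs, abs_of_nonneg (auxRmp_nonneg _)]
    exact auxRmp_le _
  have hw2 : ∀ n p, ‖(1 - w n) p‖ ≤ 1 := by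
    intro n p
    have : (1 - w n) p = ((1 - auxRmp (9 * (H p - n) - 4) : ℝ) : ℂ) := by
      simp [hw]
    rw [this, Complex.norm_real, Real.norm_eq_abs, abs_of_nonneg (by linarith [auxRmp_le (9 * (H p - n) - 4)])]
    linarith [auxRmp_nonneg (9 * (H p - n) - 4)]
  have hχs : ∀ n p, χ n p ≠ 0 → n + 1/9 ≤ H p ∧ H p ≤ n + 8/9 := by
    intro n p hp
    exact auxChi_supp (by intro h0; apply hp; simp [hχ, h0])
  have hws : ∀ n p, w n p ≠ 0 → n + 4/9 ≤ H p := by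
    intro n p hp
    by_contra hc
    apply hp
    rw [hw, auxRmp_zero (by linarith)]; simp
  have hws' : ∀ n p, (1 - w n) p ≠ 0 → H p ≤ n + 5/9 := by
    intro n p hp
    by_contra hc
    apply hp
    simp only [ContinuousMap.sub_apply, ContinuousMap.one_apply]
    rw [hw, auxRmp_one (by linarith)]; simp
  have hχc : ∀ n p, (1 - χ n) p ≠ 0 → H p ≤ n + 2/9 ∨ n + 7/9 ≤ H p := by
    intro n p hp
    by_contra hc
    push Not at hc
    apply hp
    simp only [ContinuousMap.sub_apply, ContinuousMap.one_apply]
    rw [hχ, auxChi_one hc.1.le hc.2.le]; simp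
  have hdec : (N : ℂ) • auxComp h id continuous_id
      = ∑ n ∈ Finset.range N, w n + ∑ n ∈ Finset.range N, e n := by
    rw [← Finset.sum_add_distrib]
    ext p
    rw [ContinuousMap.sum_apply]
    have : ∀ n, (w n + e n) p = ((auxRmp (H p - n) : ℝ) : ℂ) := by
      intro n
      simp only [ContinuousMap.add_apply, w, e, auxComp_apply]
      push_cast; ring
    simp_rw [this]
    rw [← Complex.ofReal_sum, auxRmp_sum]
    have hN' : (0 : ℝ) ≤ N := Nat.cast_nonneg N
    have hle : H p ≤ N := by
      rw [hH]; exact mul_le_of_le_one_right hN' (h1 p)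
    have hge : 0 ≤ H p := by rw [hH]; exact mul_nonneg hN' (h0 p)
    rw [min_eq_left hle, max_eq_right hge, hH]
    simp [auxComp_apply]
  have hfst : ∀ n, B (w n * x) ((1 - w n) * y) =
      B (χ n * (w n * x)) (χ n * ((1 - w n) * y)) := by
    intro n
    have e1 : B ((1 - χ n) * (w n * x)) ((1 - w n) * y) = 0 := by
      refine hB' H (n + 5/9) (n + 7/9) (by linarith) _ _ ?_ ?_
      · intro p hp
        exact hws' n p (left_ne_zero_of_mul hp)
      · intro p hp
        have a1 := hχc n p (left_ne_zero_of_mul hp)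
        have a2 := hws n p (left_ne_zero_of_mul (right_ne_zero_of_mul hp))
        rcases a1 with a1 | a1
        · linarith
        · exact a1
    have e2 : B (χ n * (w n * x)) ((1 - χ n) * ((1 - w n) * y)) = 0 := by
      refine hB' H (n + 2/9) (n + 4/9) (by linarith) _ _ ?_ ?_
      · intro p hp
        have a1 := hχc n p (left_ne_zero_of_mul hp)
        have a2 := hws' n p (left_ne_zero_of_mul (right_ne_zero_of_mul hp))
        rcases a1 with a1 | a1
        · exact a1
        · linarith
      · intro p hp
        exact hws n p (left_ne_zero_of_mul (right_ne_zero_of_mul hp))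
    rw [sub_mul 1 (χ n), one_mul, map_sub, LinearMap.sub_apply, sub_eq_zero] at e1
    rw [sub_mul 1 (χ n), one_mul, map_sub, sub_eq_zero] at e2
    rw [e1, e2]
  have hsnd : ∀ n, B ((1 - w n) * x) (w n * y) =
      B (χ n * ((1 - w n) * x)) (χ n * (w n * y)) := by
    intro n
    have e1 : B ((1 - w n) * x) ((1 - χ n) * (w n * y)) = 0 := by
      refine hB H (n + 5/9) (n + 7/9) (by linarith) _ _ ?_ ?_
      · intro p hp
        exact hws' n p (left_ne_zero_of_mul hp)
      · intro p hp
        have a1 := hχc n p (left_ne_zero_of_mul hp)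
        have a2 := hws n p (left_ne_zero_of_mul (right_ne_zero_of_mul hp))
        rcases a1 with a1 | a1
        · linarith
        · exact a1
    have e2 : B ((1 - χ n) * ((1 - w n) * x)) (χ n * (w n * y)) = 0 := by
      refine hB H (n + 2/9) (n + 4/9) (by linarith) _ _ ?_ ?_
      · intro p hp
        have a1 := hχc n p (left_ne_zero_of_mul hp)
        have a2 := hws' n p (left_ne_zero_of_mul (right_ne_zero_of_mul hp))
        rcases a1 with a1 | a1
        · exact a1
        · linarith
      · intro p hp
        exact hws n p (left_ne_zero_of_mul (right_ne_zero_of_mul hp))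
    rw [sub_mul 1 (χ n), one_mul, map_sub, sub_eq_zero] at e1
    rw [sub_mul 1 (χ n), one_mul, map_sub, LinearMap.sub_apply, sub_eq_zero] at e2
    rw [e1, e2]
  have hDw : ∀ n, D (w n) = B (χ n * (w n * x)) (χ n * ((1 - w n) * y))
      - B (χ n * ((1 - w n) * x)) (χ n * (w n * y)) := by
    intro n
    rw [← hfst, ← hsnd, hD]
    simp only [sub_mul, one_mul, map_sub, LinearMap.sub_apply]
    ring
  have bnd : ∀ (c d z : C(K, ℂ)) (p : K), ‖c p‖ ≤ 1 → ‖d p‖ ≤ 1 → ‖(c * (d * z)) p‖ ≤ ‖z p‖ := by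
    intro c d z p hc hd
    simp only [ContinuousMap.mul_apply, norm_mul]
    calc ‖c p‖ * (‖d p‖ * ‖z p‖) ≤ 1 * (1 * ‖z p‖) := by gcongr
      _ = _ := by ring
  have t1 := aux_diag B hC hBC H (hB H) (hB' H) x y (fun n => χ n * (w n * x))
    (fun n => χ n * ((1 - w n) * y)) (fun n p hp => hχs n p (left_ne_zero_of_mul hp))
    (fun n p hp => hχs n p (left_ne_zero_of_mul hp))
    (fun n p => bnd _ _ _ p (hχ1 n p) (hw1 n p)) (fun n p => bnd _ _ _ p (hχ1 n p) (hw2 n p)) N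
  have t2 := aux_diag B hC hBC H (hB H) (hB' H) x y (fun n => χ n * ((1 - w n) * x))
    (fun n => χ n * (w n * y)) (fun n p hp => hχs n p (left_ne_zero_of_mul hp))
    (fun n p hp => hχs n p (left_ne_zero_of_mul hp))
    (fun n p => bnd _ _ _ p (hχ1 n p) (hw2 n p)) (fun n p => bnd _ _ _ p (hχ1 n p) (hw1 n p)) N
  have t3 : ‖∑ n ∈ Finset.range N, e n‖ ≤ ‖(1 : C(K, ℂ))‖ := by
    refine aux_chi_sum_norm H N 1 e ?_ ?_
    · intro n p hp
      constructor
      · by_contra hc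
        apply hp
        simp only [e, auxComp_apply]
        rw [auxRmp_zero (by linarith), auxRmp_zero (by linarith)]; simp
      · by_contra hc
        apply hp
        simp only [e, auxComp_apply]
        rw [auxRmp_one (by linarith), auxRmp_one (by linarith)]; simp
    · intro n p
      simp only [e, auxComp_apply, Complex.norm_real, Real.norm_eq_abs, ContinuousMap.one_apply,
        norm_one]
      rw [abs_le]
      have a1 := auxRmp_nonneg (H p - n)
      have a2 := auxRmp_le (H p - n)
      have a3 := auxRmp_nonneg (9 * (H p - n) - 4)
      have a4 := auxRmp_le (9 * (H p - n) - 4)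
      constructor <;> linarith
  have hfin : (N : ℂ) * D (auxComp h id continuous_id) =
      ∑ n ∈ Finset.range N, B (χ n * (w n * x)) (χ n * ((1 - w n) * y))
      - ∑ n ∈ Finset.range N, B (χ n * ((1 - w n) * x)) (χ n * (w n * y))
      + D (∑ n ∈ Finset.range N, e n) := by
    rw [← Finset.sum_sub_distrib, ← smul_eq_mul, ← map_smul, hdec, map_add, map_sum]
    simp_rw [hDw]
  have hnn : N * ‖D (auxComp h id continuous_id)‖ = ‖(N : ℂ) * D (auxComp h id continuous_id)‖ := by
    simp
  rw [hnn, hfin]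
  have t4 : ‖D (∑ n ∈ Finset.range N, e n)‖ ≤ 2 * C * ‖(1 : C(K, ℂ))‖ * ‖x‖ * ‖y‖ :=
    (hDn _).trans (by gcongr)
  refine (norm_add_le _ _).trans (add_le_add ((norm_sub_le _ _).trans ?_) t4)
  linarith

lemma aux_bil (B : C(K, ℂ) →ₗ[ℂ] C(K, ℂ) →ₗ[ℂ] ℂ) {C : ℝ} (hC : 0 ≤ C)
    (hBC : ∀ x y, ‖B x y‖ ≤ C * ‖x‖ * ‖y‖)
    (hB : ∀ (H : C(K, ℝ)) (a b : ℝ), a < b → ∀ x y : C(K, ℂ), (∀ p, x p ≠ 0 → H p ≤ a) →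
      (∀ p, y p ≠ 0 → b ≤ H p) → B x y = 0) (f x y : C(K, ℂ)) :
    B (f * x) y = B x (f * y) := by
  have hreal : ∀ h : C(K, ℝ),
      B (auxComp h id continuous_id * x) y = B x (auxComp h id continuous_id * y) := by
    intro h
    have hc : (0 : ℝ) < ‖h‖ + 1 := by positivity
    set c := ‖h‖ + 1 with hcdef
    have hb : ∀ p, |h p| ≤ c := fun p => by
      have := h.norm_coe_le_norm p
      rw [Real.norm_eq_abs] at this
      linarith
    let h' : C(K, ℝ) := ⟨fun p => (h p + c) / (2 * c), by fun_prop⟩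
    have key := aux_bil_unit B hC hBC hB h' (fun p => by
        have := (abs_le.1 (hb p)).1
        exact div_nonneg (by linarith) (by linarith)) (fun p => by
        have := (abs_le.1 (hb p)).2
        exact (div_le_one (by linarith)).2 (by linarith)) x y
    have hdec : auxComp h id continuous_id
        = ((2 * c : ℝ) : ℂ) • auxComp h' id continuous_id - (c : ℂ) • (1 : C(K, ℂ)) := by
      ext p
      simp only [ContinuousMap.sub_apply, ContinuousMap.smul_apply, auxComp_apply, id,
        ContinuousMap.one_apply, h', ContinuousMap.coe_mk, smul_eq_mul, mul_one]
      rw [← Complex.ofReal_mul, ← Complex.ofReal_sub, Complex.ofReal_inj]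
      field_simp
      ring
    rw [hdec]
    simp only [sub_mul, smul_mul_assoc, one_mul, map_sub, map_smul, LinearMap.sub_apply,
      LinearMap.smul_apply, key]
  let re : C(K, ℝ) := ⟨fun p => (f p).re, by fun_prop⟩
  let im : C(K, ℝ) := ⟨fun p => (f p).im, by fun_prop⟩
  have hf : f = auxComp re id continuous_id + Complex.I • auxComp im id continuous_id := by
    ext p
    simp only [ContinuousMap.add_apply, ContinuousMap.smul_apply, auxComp_apply, id, re, im,
      ContinuousMap.coe_mk, smul_eq_mul]
    rw [mul_comm, Complex.re_add_im]
  rw [hf]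
  simp only [add_mul, smul_mul_assoc, map_add, map_smul, LinearMap.add_apply,
      LinearMap.smul_apply, hreal]

end BilPart

section AlgPart

variable {K : Type*} [TopologicalSpace K] [CompactSpace K]

lemma aux_split {k : ℕ} (M : ContinuousMultilinearMap ℂ (fun _ : Fin k => C(K, ℂ)) ℂ)
    (P : C(K, ℂ) → ℂ) (hM : ∀ x, P x = M (fun _ => x)) (hOA : IsOrthAdd P)
    (A : Finset (Fin k)) (hA : A.Nonempty) (hA' : ∃ j, j ∉ A) (x : Fin k → C(K, ℂ))
    (hx : ∀ i ∈ A, ∀ j ∉ A, x i * x j = 0) :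
    ∑ σ : Equiv.Perm (Fin k), M (fun i => x (σ i)) = 0 := by
  classical
  have hpol := aux_polarization M.toMultilinearMap x
  have h1 : ∀ T : Finset (Fin k), M (fun _ => ∑ i ∈ T, x i) =
      P (∑ i ∈ T with i ∈ A, x i) + P (∑ i ∈ T with i ∉ A, x i) := by
    intro T
    rw [← hM, ← hOA, Finset.sum_filter_add_sum_filter_not]
    rw [Finset.sum_mul_sum]
    refine Finset.sum_eq_zero fun i hi => Finset.sum_eq_zero fun j hj => ?_
    exact hx i (Finset.mem_filter.1 hi).2 j (Finset.mem_filter.1 hj).2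
  simp only [ContinuousMultilinearMap.coe_coe, h1, mul_add, Finset.sum_add_distrib] at hpol
  obtain ⟨a, ha⟩ := hA
  obtain ⟨b, hb⟩ := hA'
  rw [aux_toggle b (fun T => P (∑ i ∈ T with i ∈ A, x i)) (by
      intro T _
      simp only [Finset.filter_insert, hb, if_false]),
    aux_toggle a (fun T => P (∑ i ∈ T with i ∉ A, x i)) (by
      intro T _
      simp only [Finset.filter_insert, ha, not_true, if_false])] at hpol
  simpa using hpol.symm

lemma aux_alg (k : ℕ) (hk : 1 ≤ k) (P : C(K, ℂ) → ℂ)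
    (hP : IsHomogPoly k P) (hOA : IsOrthAdd P) :
    ∃ φ : C(K, ℂ) →L[ℂ] ℂ, ∀ x, P x = φ (x ^ k) := by
  classical
  obtain ⟨M, hM⟩ := hP
  let S : ContinuousMultilinearMap ℂ (fun _ : Fin k => C(K, ℂ)) ℂ :=
    ∑ σ : Equiv.Perm (Fin k), M.domDomCongr σ
  have hS : ∀ x, S x = ∑ σ : Equiv.Perm (Fin k), M (fun i => x (σ i)) := by
    intro x
    simp [S]
  have hgap : ∀ (i j : Fin k) (H : C(K, ℝ)) (a b : ℝ), a < b → ∀ x : Fin k → C(K, ℂ),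
      (∀ p, x i p ≠ 0 → H p ≤ a) → (∀ p, x j p ≠ 0 → b ≤ H p) → S x = 0 := by
    intro i j H a b hab x hi hj
    refine aux_gap S H ?_ Finset.univ a b hab {i} {j} (by simp) (by simp) (by simp) x
      (by simpa using hi) (by simpa using hj)
    intro a b hab A hA hA' x h1 h2
    rw [hS]
    refine aux_split M P hM hOA A hA hA' x fun i hi j hj => ?_
    ext p
    simp only [ContinuousMap.mul_apply, ContinuousMap.zero_apply]
    by_contra hne
    have := h1 i hi p (left_ne_zero_of_mul hne)
    have := h2 j hj p (right_ne_zero_of_mul hne)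
    linarith
  have hmod : ∀ (i j : Fin k), i ≠ j → ∀ (x : Fin k → C(K, ℂ)) (f y z : C(K, ℂ)),
      S (Function.update (Function.update x i (f * y)) j z) =
      S (Function.update (Function.update x i y) j (f * z)) := by
    intro i j hij x f y z
    let B : C(K, ℂ) →ₗ[ℂ] C(K, ℂ) →ₗ[ℂ] ℂ := LinearMap.mk₂ ℂ
      (fun y z => S (Function.update (Function.update x i y) j z))
      (by intro a b c; simp only [Function.update_comm hij, S.map_update_add])
      (by intro a b c; simp only [Function.update_comm hij, S.map_update_smul])
      (by intro a b c; simp only [S.map_update_add])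
      (by intro a b c; simp only [S.map_update_smul])
    have hBdef : ∀ y z, B y z = S (Function.update (Function.update x i y) j z) := fun y z => rfl
    let C : ℝ := ‖S‖ * ∏ l ∈ (Finset.univ.erase i).erase j, ‖x l‖
    have hC : 0 ≤ C := by positivity
    have hBC : ∀ y z, ‖B y z‖ ≤ C * ‖y‖ * ‖z‖ := by
      intro y z
      rw [hBdef]
      refine (S.le_opNorm _).trans (le_of_eq ?_)
      rw [← Finset.mul_prod_erase Finset.univ _ (Finset.mem_univ i),
        ← Finset.mul_prod_erase (Finset.univ.erase i) _
          (Finset.mem_erase.2 ⟨hij.symm, Finset.mem_univ j⟩)]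
      have : ∏ l ∈ (Finset.univ.erase i).erase j,
          ‖Function.update (Function.update x i y) j z l‖ =
          ∏ l ∈ (Finset.univ.erase i).erase j, ‖x l‖ := by
        refine Finset.prod_congr rfl fun l hl => ?_
        simp only [Finset.mem_erase] at hl
        rw [Function.update_of_ne hl.1, Function.update_of_ne hl.2.1]
      rw [this, Function.update_self, Function.update_of_ne hij, Function.update_self]
      simp only [C]
      ring
    have := aux_bil B hC hBC (by
      intro H a b hab y z hy hz
      rw [hBdef]
      refine hgap i j H a b hab _ ?_ ?_
      · rw [Function.update_of_ne hij, Function.update_self]; exact hy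
      · rw [Function.update_self]; exact hz) f y z
    exact this
  let i0 : Fin k := ⟨0, hk⟩
  have hclaim : ∀ (x : C(K, ℂ)) (T : Finset (Fin k)), i0 ∉ T → ∀ z : C(K, ℂ),
      S (Function.update (fun i => if i ∈ T then x else 1) i0 z) =
      S (Function.update (fun _ => 1) i0 (x ^ T.card * z)) := by
    intro x T
    induction T using Finset.induction_on with
    | empty => intro _ z; simp
    | insert j T hj ih =>
      intro hi z
      have hij : i0 ≠ j := fun h => hi (by simp [h])
      have hiT : i0 ∉ T := fun h => hi (by simp [h])
      have e1 : Function.update (fun i => if i ∈ insert j T then x else 1) i0 z =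
          Function.update (Function.update (fun i => if i ∈ T then x else 1) i0 z) j (x * 1) := by
        funext l
        by_cases hl : l = j
        · subst hl
          rw [Function.update_self, Function.update_of_ne hij.symm]; simp
        · rw [Function.update_of_ne hl]
          by_cases hl' : l = i0
          · subst hl'; simp
          · rw [Function.update_of_ne hl', Function.update_of_ne hl']; simp [hl]
      have e2 : Function.update (fun i => if i ∈ T then x else 1) i0 (x * z) =
          Function.update (Function.update (fun i => if i ∈ T then x else 1) i0 (x * z)) j 1 := by
        funext l
        by_cases hl : l = j
        · subst hl
          rw [Function.update_self, Function.update_of_ne hij.symm]; simp [hj]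
        · rw [Function.update_of_ne hl]
      rw [e1, ← hmod i0 j hij, ← e2, ih hiT, Finset.card_insert_of_notMem hj, pow_succ, mul_assoc]
  refine ⟨((k.factorial : ℂ)⁻¹) • S.toContinuousLinearMap (fun _ => 1) i0, fun x => ?_⟩
  have h1 : S (fun _ => x) = k.factorial * P x := by
    rw [hS, hM]; simp [Fintype.card_perm]
  have h2 := hclaim x (Finset.univ.erase i0) (Finset.notMem_erase _ _) x
  have h3 : Function.update (fun i => if i ∈ Finset.univ.erase i0 then x else 1) i0 x
      = fun _ => x := by
    funext l
    by_cases hl : l = i0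
    · subst hl; simp
    · rw [Function.update_of_ne hl]; simp [hl]
  rw [h3, h1, Finset.card_erase_of_mem (Finset.mem_univ _), Finset.card_univ, Fintype.card_fin,
    pow_sub_one_mul (by omega)] at h2
  have hfac : (k.factorial : ℂ) ≠ 0 := by exact_mod_cast k.factorial_ne_zero
  change P x = (k.factorial : ℂ)⁻¹ * S (Function.update (fun _ => 1) i0 (x ^ k))
  rw [← h2]
  field_simp

end AlgPart

section RieszPart

open scoped NNReal CompactlySupported

variable {K : Type*} [TopologicalSpace K] [CompactSpace K]

def auxSet (φ : C(K, ℂ) →L[ℂ] ℂ) (f : K → ℝ≥0) : Set ℝ :=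
  {r | ∃ g : C(K, ℂ), (∀ p, ‖g p‖ ≤ f p) ∧ r = ‖φ g‖}

noncomputable def auxP (φ : C(K, ℂ) →L[ℂ] ℂ) (f : K → ℝ≥0) : ℝ := sSup (auxSet φ f)

lemma auxSet_bdd (φ : C(K, ℂ) →L[ℂ] ℂ) (f : K → ℝ≥0) (hf : Continuous f) :
    BddAbove (auxSet φ f) := by
  obtain ⟨c, hc⟩ := isCompact_univ.exists_bound_of_continuousOn
    (f := fun p => (f p : ℝ)) (by fun_prop)
  refine ⟨‖φ‖ * |c|, ?_⟩
  rintro r ⟨g, hg, rfl⟩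
  refine (φ.le_opNorm g).trans ?_
  gcongr
  refine (ContinuousMap.norm_le _ (abs_nonneg _)).2 fun p => (hg p).trans ?_
  exact (le_abs_self _).trans ((hc p (Set.mem_univ p)).trans (le_abs_self _))

lemma auxSet_zero_mem (φ : C(K, ℂ) →L[ℂ] ℂ) (f : K → ℝ≥0) : 0 ∈ auxSet φ f :=
  ⟨0, by simp, by simp⟩

lemma auxP_nonneg (φ : C(K, ℂ) →L[ℂ] ℂ) (f : K → ℝ≥0) (hf : Continuous f) : 0 ≤ auxP φ f :=
  le_csSup (auxSet_bdd φ f hf) (auxSet_zero_mem φ f)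

lemma auxP_le (φ : C(K, ℂ) →L[ℂ] ℂ) (f : K → ℝ≥0) (hf : Continuous f) (g : C(K, ℂ))
    (hg : ∀ p, ‖g p‖ ≤ f p) : ‖φ g‖ ≤ auxP φ f :=
  le_csSup (auxSet_bdd φ f hf) ⟨g, hg, rfl⟩

lemma auxP_le_of (φ : C(K, ℂ) →L[ℂ] ℂ) (f : K → ℝ≥0) {r : ℝ}
    (h : ∀ g : C(K, ℂ), (∀ p, ‖g p‖ ≤ f p) → ‖φ g‖ ≤ r) : auxP φ f ≤ r := by
  refine csSup_le ⟨0, auxSet_zero_mem φ f⟩ ?_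
  rintro _ ⟨g, hg, rfl⟩
  exact h g hg

lemma auxP_add (φ : C(K, ℂ) →L[ℂ] ℂ) (f₁ f₂ : K → ℝ≥0) (h₁ : Continuous f₁)
    (h₂ : Continuous f₂) : auxP φ (f₁ + f₂) = auxP φ f₁ + auxP φ f₂ := by
  have h₁₂ : Continuous (f₁ + f₂) := h₁.add h₂
  apply le_antisymm
  · refine auxP_le_of φ _ fun g hg => ?_
    refine le_of_forall_pos_le_add fun δ hδ => ?_
    obtain ⟨ε, hε, hεδ⟩ : ∃ ε : ℝ, 0 < ε ∧ ‖φ‖ * ε ≤ δ := by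
      refine ⟨δ / (‖φ‖ + 1), by positivity, ?_⟩
      rw [mul_div_assoc', div_le_iff₀ (by positivity)]
      nlinarith [norm_nonneg φ]
    have hden : ∀ p, (0 : ℝ) < f₁ p + f₂ p + ε := fun p => by positivity
    have part : ∀ f : K → ℝ≥0, Continuous f → Continuous fun p =>
        g p * (((f p : ℝ) / (f₁ p + f₂ p + ε) : ℝ) : ℂ) := by
      intro f hf
      have : Continuous fun p => ((f p : ℝ) / (f₁ p + f₂ p + ε) : ℝ) :=
        Continuous.div (by fun_prop) (by fun_prop) fun p => (hden p).ne'
      fun_prop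
    let g₁ : C(K, ℂ) := ⟨_, part f₁ h₁⟩
    let g₂ : C(K, ℂ) := ⟨_, part f₂ h₂⟩
    have bd : ∀ p, ∀ c : ℝ, 0 ≤ c → ‖g p * ((c / (f₁ p + f₂ p + ε) : ℝ) : ℂ)‖ ≤ c := by
      intro p c hc
      rw [norm_mul, Complex.norm_real, Real.norm_eq_abs,
        abs_of_nonneg (div_nonneg hc (hden p).le), mul_div_assoc', div_le_iff₀ (hden p), mul_comm]
      gcongr
      have := hg p
      simp only [Pi.add_apply, NNReal.coe_add] at this
      linarith
    have hr : ‖g - g₁ - g₂‖ ≤ ε := by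
      refine (ContinuousMap.norm_le _ hε.le).2 fun p => ?_
      have : (g - g₁ - g₂) p = g p * ((ε / (f₁ p + f₂ p + ε) : ℝ) : ℂ) := by
        have h0 : ((f₁ p : ℝ) / (f₁ p + f₂ p + ε) + (f₂ p : ℝ) / (f₁ p + f₂ p + ε)
          + ε / (f₁ p + f₂ p + ε)) = 1 := by
          have := (hden p).ne'
          field_simp
        have h1 : ((((f₁ p : ℝ) / (f₁ p + f₂ p + ε) : ℝ) : ℂ) +
          (((f₂ p : ℝ) / (f₁ p + f₂ p + ε) : ℝ) : ℂ)
          + ((ε / (f₁ p + f₂ p + ε) : ℝ) : ℂ)) = 1 := by exact_mod_cast h0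
        simp only [ContinuousMap.sub_apply, g₁, g₂, ContinuousMap.coe_mk]
        linear_combination (-g p) * h1
      rw [this]
      exact bd p ε hε.le
    have e : φ g = φ g₁ + φ g₂ + φ (g - g₁ - g₂) := by
      rw [← map_add, ← map_add]; congr 1; abel
    rw [e]
    have i1 := auxP_le φ f₁ h₁ g₁ fun p => bd p _ (f₁ p).2
    have i2 := auxP_le φ f₂ h₂ g₂ fun p => bd p _ (f₂ p).2
    have i3 : ‖φ (g - g₁ - g₂)‖ ≤ δ := (φ.le_opNorm _).trans (le_trans (by gcongr) hεδ)
    refine (norm_add₃_le).trans ?_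
    linarith
  · rw [← le_sub_iff_add_le]
    refine auxP_le_of φ _ fun g₁ hg₁ => ?_
    rw [le_sub_iff_add_le, ← le_sub_iff_add_le']
    refine auxP_le_of φ _ fun g₂ hg₂ => ?_
    rw [le_sub_iff_add_le']
    obtain ⟨c₁, hc₁, e₁⟩ := RCLike.exists_norm_eq_mul_self (φ g₁)
    obtain ⟨c₂, hc₂, e₂⟩ := RCLike.exists_norm_eq_mul_self (φ g₂)
    have hmem := auxP_le φ (f₁ + f₂) h₁₂ (c₁ • g₁ + c₂ • g₂) (by
      intro p
      simp only [ContinuousMap.add_apply, ContinuousMap.smul_apply, Pi.add_apply, NNReal.coe_add]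
      refine (norm_add_le _ _).trans ?_
      rw [norm_smul, norm_smul, hc₁, hc₂, one_mul, one_mul]
      exact add_le_add (hg₁ p) (hg₂ p))
    rw [map_add, map_smul, map_smul, smul_eq_mul, smul_eq_mul, ← e₁, ← e₂] at hmem
    refine le_trans (le_of_eq ?_) hmem
    have : ((‖φ g₁‖ : ℂ) + (‖φ g₂‖ : ℂ)) = ((‖φ g₁‖ + ‖φ g₂‖ : ℝ) : ℂ) := by push_cast; rfl
    change _ = ‖((‖φ g₁‖ : ℂ) + (‖φ g₂‖ : ℂ))‖
    rw [this, Complex.norm_real, Real.norm_eq_abs, abs_of_nonneg (by positivity)]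

lemma auxP_smul_le (φ : C(K, ℂ) →L[ℂ] ℂ) (f : K → ℝ≥0) (hf : Continuous f) (c : ℝ≥0)
    (hc : c ≠ 0) : auxP φ (c • f) ≤ c * auxP φ f := by
  have hc' : (0 : ℝ) < c := by positivity
  refine auxP_le_of φ _ fun g hg => ?_
  have := auxP_le φ f hf (((c⁻¹ : ℝ≥0) : ℂ) • g) (by
    intro p
    have h1 := hg p
    simp only [Pi.smul_apply, smul_eq_mul, NNReal.coe_mul] at h1
    simp only [ContinuousMap.smul_apply, norm_smul]
    have : ‖((c⁻¹ : ℝ≥0) : ℂ)‖ = (c : ℝ)⁻¹ := by simp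
    rw [this, inv_mul_le_iff₀ hc']
    exact h1)
  rw [map_smul, norm_smul] at this
  have h2 : ‖((c⁻¹ : ℝ≥0) : ℂ)‖ = (c : ℝ)⁻¹ := by simp
  rwa [h2, inv_mul_le_iff₀ hc'] at this

lemma auxP_smul (φ : C(K, ℂ) →L[ℂ] ℂ) (f : K → ℝ≥0) (hf : Continuous f) (c : ℝ≥0) :
    auxP φ (c • f) = c * auxP φ f := by
  by_cases hc : c = 0
  · subst hc
    simp only [NNReal.coe_zero, zero_mul]
    refine le_antisymm (auxP_le_of φ _ fun g hg => ?_) (auxP_nonneg φ _ (hf.const_smul _))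
    have : g = 0 := by
      ext p
      simpa using hg p
    simp [this]
  · refine le_antisymm (auxP_smul_le φ f hf c hc) ?_
    have h := auxP_smul_le φ (c • f) (hf.const_smul _) c⁻¹ (inv_ne_zero hc)
    rw [smul_smul, inv_mul_cancel₀ hc, one_smul] at h
    have hc' : (0 : ℝ) < c := by positivity
    rw [NNReal.coe_inv, inv_mul_eq_div, le_div_iff₀ hc'] at h
    linarith

lemma aux_riesz [T2Space K] [MeasurableSpace K] [BorelSpace K] (φ : C(K, ℂ) →L[ℂ] ℂ) :
    ∃ (μ : Measure K) (w : K → ℂ), IsFiniteMeasure μ ∧ μ.WeaklyRegular ∧ Measurable w ∧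
      Integrable w μ ∧ ∀ f : C(K, ℂ), φ f = ∫ p, f p * w p ∂μ := by
  let Λ : C_c(K, ℝ≥0) →ₗ[ℝ≥0] ℝ≥0 :=
    { toFun := fun f => ⟨auxP φ f, auxP_nonneg φ f f.continuous⟩
      map_add' := by
        intro f g
        ext
        exact auxP_add φ f g f.continuous g.continuous
      map_smul' := by
        intro c f
        ext
        exact auxP_smul φ f f.continuous c }
  have hΛ : ∀ f, (Λ f : ℝ) = auxP φ f := fun f => rfl
  let μ := NNRealRMK.rieszMeasure Λ
  have hbound : ∀ g : C(K, ℂ), ‖φ g‖ ≤ ∫ p, ‖g p‖ ∂μ := by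
    intro g
    let f : C_c(K, ℝ≥0) := ⟨⟨fun p => ‖g p‖₊, by fun_prop⟩, HasCompactSupport.of_compactSpace _⟩
    have h1 := NNRealRMK.integral_rieszMeasure Λ f
    rw [hΛ] at h1
    have h2 := auxP_le φ f f.continuous g (fun p => le_rfl)
    rw [← h1] at h2
    exact h2
  have : IsFiniteMeasure μ := inferInstance
  have : μ.Regular := inferInstance
  have : μ.WeaklyRegular := inferInstance
  let e : C(K, ℂ) →ₗ[ℂ] Lp ℂ 2 μ := (ContinuousMap.toLp 2 μ ℂ : C(K, ℂ) →L[ℂ] Lp ℂ 2 μ).toLinearMap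
  have hdense : DenseRange e := ContinuousMap.toLp_denseRange ℂ μ ℂ (by simp)
  have hnorm : ∃ C, ∀ x, ‖φ.toLinearMap x‖ ≤ C * ‖e x‖ := by
    refine ⟨(μ Set.univ ^ (1/2 : ℝ)).toReal, fun g => ?_⟩
    refine (hbound g).trans ?_
    have hg : AEStronglyMeasurable g μ := g.continuous.aestronglyMeasurable
    have h1 := eLpNorm_le_eLpNorm_mul_rpow_measure_univ (p := 1) (q := 2) (μ := μ) (by norm_num) hg
    have h2 : ∫ p, ‖g p‖ ∂μ = (eLpNorm g 1 μ).toReal := by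
      rw [eLpNorm_one_eq_lintegral_enorm, integral_norm_eq_lintegral_enorm hg]
    have h3 : ‖e g‖ = (eLpNorm g 2 μ).toReal := by
      rw [Lp.norm_def]
      congr 1
      exact eLpNorm_congr_ae (ContinuousMap.coeFn_toLp μ g)
    rw [h2, h3, mul_comm, ← ENNReal.toReal_mul]
    have hfin : eLpNorm g 2 μ ≠ ⊤ := by
      rw [← eLpNorm_congr_ae (ContinuousMap.coeFn_toLp (p := 2) (𝕜 := ℂ) μ g)]
      exact Lp.eLpNorm_ne_top _
    refine ENNReal.toReal_mono ?_ (h1.trans (le_of_eq ?_))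
    · exact ENNReal.mul_ne_top hfin (ENNReal.rpow_ne_top_of_nonneg (by norm_num) (measure_ne_top _ _))
    · norm_num
  let ψ := φ.toLinearMap.extendOfNorm e
  have hψ : ∀ g, ψ (e g) = φ g := fun g => LinearMap.extendOfNorm_eq hdense hnorm g
  let W : Lp ℂ 2 μ := (InnerProductSpace.toDual ℂ (Lp ℂ 2 μ)).symm ψ
  have hW : ∀ g, φ g = inner ℂ W (e g) := by
    intro g
    rw [← hψ, InnerProductSpace.toDual_symm_apply]
  have hWm : AEStronglyMeasurable (fun p => (starRingEnd ℂ) (W p)) μ :=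
    Complex.continuous_conj.comp_aestronglyMeasurable (Lp.aestronglyMeasurable W)
  have hWi : Integrable (fun p => (starRingEnd ℂ) (W p)) μ := by
    have : Integrable W μ := (Lp.memLp W).integrable (by norm_num)
    exact (LinearIsometryEquiv.integrable_comp_iff (Complex.conjLIE) (φ := W)).2 this
  refine ⟨μ, hWm.mk _, inferInstance, inferInstance, hWm.stronglyMeasurable_mk.measurable,
    hWi.congr hWm.ae_eq_mk, fun f => ?_⟩
  rw [hW, L2.inner_def]
  refine integral_congr_ae ?_
  filter_upwards [hWm.ae_eq_mk, ContinuousMap.coeFn_toLp (p := 2) (𝕜 := ℂ) μ f] with p h1 h2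
  rw [← h1]
  change inner ℂ (W p) ((ContinuousMap.toLp 2 μ ℂ f : Lp ℂ 2 μ) p) = _
  rw [h2]
  simp [RCLike.inner_apply]

end RieszPart

section FinalPart

variable {K : Type*} [TopologicalSpace K] [CompactSpace K]

/-- phase -/
noncomputable def auxPhase (z : ℂ) : ℂ := if z = 0 then 1 else z / (‖z‖ : ℂ)

lemma auxPhase_norm (z : ℂ) : ‖auxPhase z‖ = 1 := by
  unfold auxPhase
  split_ifs with h
  · simp
  · rw [norm_div, Complex.norm_real, norm_norm, div_self (norm_ne_zero_iff.2 h)]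

lemma auxPhase_mul (z : ℂ) : (‖z‖ : ℂ) * auxPhase z = z := by
  unfold auxPhase
  split_ifs with h
  · simp [h]
  · have : (‖z‖ : ℂ) ≠ 0 := by simpa using h
    field_simp

lemma auxPhase_meas : Measurable auxPhase := by
  unfold auxPhase
  refine Measurable.ite (measurableSet_singleton 0) measurable_const ?_
  exact measurable_id.div (Complex.measurable_ofReal.comp measurable_norm)

/-- evaluation -/
noncomputable def auxEval (p : K) : DualBall K :=
  ⟨ContinuousMap.evalCLM ℂ p, fun x => x.norm_coe_le_norm p⟩

lemma auxEval_apply (p : K) (x : C(K, ℂ)) : (auxEval p).1 x = x p := rfl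

lemma auxEval_closed [T2Space K] : IsClosedEmbedding (auxEval (K := K)) := by
  refine Continuous.isClosedEmbedding ?_ ?_
  · refine Continuous.subtype_mk ?_ _
    refine WeakBilin.continuous_of_continuous_eval _ ?_
    intro x
    exact x.continuous
  · intro p q hpq
    by_contra hne
    obtain ⟨f, h0, h1, -⟩ := exists_continuous_zero_one_of_isClosed (isClosed_singleton (x := p))
      (isClosed_singleton (x := q)) (by simpa using hne)
    let g : C(K, ℂ) := ⟨fun p => ((f p : ℝ) : ℂ), by fun_prop⟩
    have := congrArg (fun γ : DualBall K => γ.1 g) hpq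
    simp only [auxEval_apply, g, ContinuousMap.coe_mk] at this
    rw [h0 rfl, h1 rfl] at this
    simp at this

lemma auxPolyNorm_bdd {k : ℕ} {P : C(K, ℂ) → ℂ} (φ : C(K, ℂ) →L[ℂ] ℂ) (h : ∀ x, P x = φ (x ^ k)) :
    BddAbove ((fun x => ‖P x‖) '' Metric.closedBall (0 : C(K, ℂ)) 1) := by
  refine ⟨‖φ‖ * 1, ?_⟩
  rintro _ ⟨x, hx, rfl⟩
  have hx' : ‖x‖ ≤ 1 := by simpa using hx
  simp only [h]
  refine (φ.le_opNorm _).trans ?_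
  gcongr
  refine (ContinuousMap.norm_le _ zero_le_one).2 fun p => ?_
  simp only [ContinuousMap.pow_apply, norm_pow]
  exact pow_le_one₀ (norm_nonneg _) ((x.norm_coe_le_norm p).trans hx')

lemma aux_tv [T2Space K] [MeasurableSpace K] [BorelSpace K] {k : ℕ} (hk : 1 ≤ k)
    {P : C(K, ℂ) → ℂ}
    (hbdd : BddAbove ((fun x => ‖P x‖) '' Metric.closedBall (0 : C(K, ℂ)) 1))
    (μ : Measure K) (w : K → ℂ) [IsFiniteMeasure μ] [μ.WeaklyRegular] (hw : Measurable w)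
    (hwi : Integrable w μ) (hP : ∀ x : C(K, ℂ), P x = ∫ p, x p ^ k * w p ∂μ) :
    ∫ p, ‖w p‖ ∂μ ≤ polyNorm P := by
  let v : K → ℂ := fun p => ((starRingEnd ℂ) (auxPhase (w p))) ^ ((k : ℂ)⁻¹)
  have hvk : ∀ p, v p ^ k = (starRingEnd ℂ) (auxPhase (w p)) := fun p =>
    Complex.cpow_nat_inv_pow _ (by omega)
  have hv1 : ∀ p, ‖v p‖ = 1 := by
    intro p
    have : ‖v p‖ ^ k = 1 := by rw [← norm_pow, hvk]; simp [auxPhase_norm]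
    exact (pow_eq_one_iff_of_nonneg (norm_nonneg _) (by omega)).1 this
  have hvm : Measurable v := by
    have h1 : Measurable fun p => (starRingEnd ℂ) (auxPhase (w p)) :=
      Complex.continuous_conj.measurable.comp (auxPhase_meas.comp hw)
    exact h1.pow_const _
  have hvL : MemLp v 1 μ := MemLp.of_bound hvm.aestronglyMeasurable 1
    (Filter.Eventually.of_forall fun p => (hv1 p).le)
  have happ : ∀ n : ℕ, ∃ g : BoundedContinuousFunction K ℂ,
      eLpNorm (v - ⇑g) 1 μ ≤ ENNReal.ofReal (1 / (n + 1)) ∧ MemLp g 1 μ := fun n =>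
    hvL.exists_boundedContinuous_eLpNorm_sub_le (by simp)
      (by simp only [ne_eq, ENNReal.ofReal_eq_zero, not_le]; positivity)
  choose g hg hgm using happ
  have htm : TendstoInMeasure μ (fun n => ⇑(g n)) atTop v := by
    refine tendstoInMeasure_of_tendsto_eLpNorm one_ne_zero
      (fun n => (hgm n).1) hvL.1 ?_
    have hz : Tendsto (fun n : ℕ => ENNReal.ofReal (1 / ((n : ℝ) + 1))) atTop (𝓝 0) := by
      rw [← ENNReal.ofReal_zero]
      exact ENNReal.tendsto_ofReal tendsto_one_div_add_atTop_nhds_zero_nat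
    refine tendsto_of_tendsto_of_tendsto_of_le_of_le tendsto_const_nhds hz (fun _ => zero_le) ?_
    intro n
    change eLpNorm (⇑(g n) - v) 1 μ ≤ _
    rw [eLpNorm_sub_comm]
    exact hg n
  obtain ⟨ns, -, hns⟩ := htm.exists_seq_tendsto_ae
  let r : ℂ → ℂ := fun z => z / ((max 1 ‖z‖ : ℝ) : ℂ)
  have hrc : Continuous r := by
    refine Continuous.div continuous_id (by fun_prop) fun z => ?_
    have : (0 : ℝ) < max 1 ‖z‖ := lt_of_lt_of_le one_pos (le_max_left _ _)
    exact_mod_cast this.ne'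
  have hr1 : ∀ z, ‖r z‖ ≤ 1 := by
    intro z
    have : (0 : ℝ) < max 1 ‖z‖ := lt_of_lt_of_le one_pos (le_max_left _ _)
    simp only [r]
    rw [norm_div, Complex.norm_real, Real.norm_eq_abs, abs_of_pos this, div_le_one this]
    exact le_max_right _ _
  have hrv : ∀ p, r (v p) = v p := by
    intro p
    simp [r, hv1]
  let x : ℕ → C(K, ℂ) := fun n => ⟨fun p => r (g (ns n) p), hrc.comp (g (ns n)).continuous⟩
  have hlim : Tendsto (fun n => ∫ p, x n p ^ k * w p ∂μ) atTop (𝓝 (∫ p, v p ^ k * w p ∂μ)) := by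
    refine tendsto_integral_of_dominated_convergence (fun p => ‖w p‖) ?_ hwi.norm ?_ ?_
    · intro n
      exact (((x n).continuous.pow k).measurable.mul hw).aestronglyMeasurable
    · intro n
      refine Filter.Eventually.of_forall fun p => ?_
      rw [norm_mul, norm_pow]
      exact mul_le_of_le_one_left (norm_nonneg _) (pow_le_one₀ (norm_nonneg _) (hr1 _))
    · filter_upwards [hns] with p hp
      have h1 : Tendsto (fun n => r (g (ns n) p)) atTop (𝓝 (v p)) := by
        have := (hrc.tendsto (v p)).comp hp
        rw [hrv] at this
        exact this
      exact (h1.pow k).mul_const _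
  have hval : ∫ p, v p ^ k * w p ∂μ = ((∫ p, ‖w p‖ ∂μ : ℝ) : ℂ) := by
    rw [← integral_complex_ofReal]
    congr 1
    funext p
    rw [hvk]
    conv_lhs => rw [← auxPhase_mul (w p)]
    have h1 : (starRingEnd ℂ) (auxPhase (w p)) * auxPhase (w p) = 1 := by
      rw [mul_comm, Complex.mul_conj, Complex.normSq_eq_norm_sq, auxPhase_norm]; simp
    have h2 : auxPhase ((‖w p‖ : ℂ) * auxPhase (w p)) = auxPhase (w p) := by rw [auxPhase_mul]
    rw [h2]
    linear_combination (‖w p‖ : ℂ) * h1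
  rw [hval] at hlim
  have hlim2 := hlim.norm
  rw [Complex.norm_real, Real.norm_eq_abs, abs_of_nonneg (integral_nonneg fun p => norm_nonneg _)]
    at hlim2
  refine le_of_tendsto' hlim2 fun n => ?_
  rw [← hP]
  refine le_csSup hbdd ⟨x n, ?_, rfl⟩
  rw [mem_closedBall_zero_iff]
  exact (ContinuousMap.norm_le _ zero_le_one).2 fun p => hr1 _

lemma aux_exists [T2Space K] {k : ℕ} (hk : 1 ≤ k) {P : C(K, ℂ) → ℂ}
    (φ : C(K, ℂ) →L[ℂ] ℂ) (h : ∀ x, P x = φ (x ^ k)) :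
    ∃ (ν : Measure (DualBall K)) (w : DualBall K → ℂ),
        IsFiniteMeasure ν ∧ Measurable w ∧ (∀ γ, ‖w γ‖ = 1) ∧
        (∀ x : C(K, ℂ), P x = ∫ γ, (γ.1 x) ^ k * w γ ∂ν) ∧
        (ν Set.univ).toReal ≤ polyNorm P := by
  letI : MeasurableSpace K := borel K
  haveI : BorelSpace K := ⟨rfl⟩
  haveI : BorelSpace (DualBall K) := ⟨rfl⟩
  obtain ⟨μ, w, hfin, hreg, hw, hwi, hφ⟩ := aux_riesz φ
  have hP : ∀ x : C(K, ℂ), P x = ∫ p, x p ^ k * w p ∂μ := by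
    intro x
    rw [h, hφ]
    rfl
  have htv := aux_tv hk (auxPolyNorm_bdd φ h) μ w hw hwi hP
  have hemb : MeasurableEmbedding (auxEval (K := K)) := auxEval_closed.measurableEmbedding
  let ν₀ : Measure K := μ.withDensity fun p => (‖w p‖₊ : ENNReal)
  have hν₀ : ν₀ Set.univ = ENNReal.ofReal (∫ p, ‖w p‖ ∂μ) := by
    rw [withDensity_apply _ MeasurableSet.univ, Measure.restrict_univ,
      ofReal_integral_norm_eq_lintegral_enorm hwi]
    rfl
  let w' : DualBall K → ℂ := Function.extend auxEval (fun p => auxPhase (w p)) (fun _ => 1)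
  have hw'e : ∀ p, w' (auxEval p) = auxPhase (w p) := fun p => hemb.injective.extend_apply _ _ _
  refine ⟨ν₀.map auxEval, w', ?_, ?_, ?_, ?_, ?_⟩
  · have : IsFiniteMeasure ν₀ := ⟨by rw [hν₀]; exact ENNReal.ofReal_lt_top⟩
    infer_instance
  · exact hemb.measurable_extend (auxPhase_meas.comp hw) measurable_const
  · intro γ
    by_cases hγ : ∃ p, auxEval p = γ
    · obtain ⟨p, rfl⟩ := hγ
      rw [hw'e, auxPhase_norm]
    · simp [w', Function.extend_apply' _ _ _ hγ]
  · intro x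
    rw [hemb.integral_map, hP]
    simp only [auxEval_apply, hw'e]
    rw [integral_withDensity_eq_integral_smul (hw.nnnorm)]
    congr 1
    funext p
    rw [NNReal.smul_def, coe_nnnorm, Complex.real_smul]
    conv_lhs => rw [← auxPhase_mul (w p)]
    have h2 : auxPhase ((‖w p‖ : ℂ) * auxPhase (w p)) = auxPhase (w p) := by rw [auxPhase_mul]
    ring
  · rw [hemb.map_apply, Set.preimage_univ, hν₀, ENNReal.toReal_ofReal
      (integral_nonneg fun p => norm_nonneg _)]
    exact htv

lemma aux_lower {k : ℕ} {P : C(K, ℂ) → ℂ} (ν : Measure (DualBall K)) (w : DualBall K → ℂ)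
    (hν : IsFiniteMeasure ν) (hw : ∀ γ, ‖w γ‖ = 1)
    (hP : ∀ x : C(K, ℂ), P x = ∫ γ, (γ.1 x) ^ k * w γ ∂ν) :
    polyNorm P ≤ (ν Set.univ).toReal := by
  refine csSup_le ⟨_, 0, by simp, rfl⟩ ?_
  rintro _ ⟨x, hx, rfl⟩
  have hx' : ‖x‖ ≤ 1 := by simpa using hx
  simp only [hP]
  have := norm_integral_le_of_norm_le_const (μ := ν) (C := 1)
    (f := fun γ : DualBall K => (γ.1 x) ^ k * w γ) (Filter.Eventually.of_forall fun γ => by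
      rw [norm_mul, hw, mul_one, norm_pow]
      exact pow_le_one₀ (norm_nonneg _) ((γ.2 x).trans hx'))
  simpa [Measure.real] using this

end FinalPart

/-- For an orthogonally additive continuous `k`-homogeneous polynomial `P` on
`C(K)`, the set of total variations of complex Borel measures on the weak-*
dual unit ball representing `P` (measures encoded in polar form `w · ν` with
`ν` finite positive and `w` unimodular, so the total variation is `ν(B')`) is
nonempty, and its infimum equals `‖P‖ = sup_{‖x‖ ≤ 1} |P x|`: the integral and
usual norms of `P` coincide. -/
theorem orthAdd_homogPoly_integralNorm_eq_norm
    {K : Type*} [TopologicalSpace K] [CompactSpace K] [T2Space K]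
    (k : ℕ) (hk : 1 ≤ k) (P : C(K, ℂ) → ℂ)
    (hP : IsHomogPoly k P) (hOA : IsOrthAdd P) :
    ({r : ℝ | ∃ (ν : Measure (DualBall K)) (w : DualBall K → ℂ),
        IsFiniteMeasure ν ∧ Measurable w ∧ (∀ γ, ‖w γ‖ = 1) ∧
        (∀ x : C(K, ℂ), P x = ∫ γ, (γ.1 x) ^ k * w γ ∂ν) ∧
        r = (ν Set.univ).toReal}).Nonempty ∧
    sInf {r : ℝ | ∃ (ν : Measure (DualBall K)) (w : DualBall K → ℂ),
        IsFiniteMeasure ν ∧ Measurable w ∧ (∀ γ, ‖w γ‖ = 1) ∧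
        (∀ x : C(K, ℂ), P x = ∫ γ, (γ.1 x) ^ k * w γ ∂ν) ∧
        r = (ν Set.univ).toReal} = polyNorm P := by

  obtain ⟨φ, hφ⟩ := aux_alg k hk P hP hOA
  obtain ⟨ν, w, h1, h2, h3, h4, h5⟩ := aux_exists hk φ hφ
  refine ⟨⟨_, ν, w, h1, h2, h3, h4, rfl⟩, le_antisymm ?_ ?_⟩
  · refine le_trans (csInf_le (a := (ν Set.univ).toReal) ⟨0, ?_⟩ ⟨ν, w, h1, h2, h3, h4, rfl⟩) h5
    rintro r ⟨_, _, _, _, _, _, rfl⟩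
    exact ENNReal.toReal_nonneg
  · refine le_csInf ⟨_, ν, w, h1, h2, h3, h4, rfl⟩ ?_
    rintro r ⟨ν', w', g1, _, g3, g4, rfl⟩
    exact aux_lower ν' w' g1 g3 g4
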